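/- Let K be a field, G a finite subgroup of PGL₂(K) with quotient map Q_G, and F ∈ K[x] monic irreducible such that every root v of F^{Q_G} satisfies |G∘v| = |G| (all orbits regular). Then F^{Q_G} equals the product of the distinct polynomials in the G-orbit G∗r of some monic irreducible r (i.e., the exponent k in the Main Theorem equals 1). -/

import Mathlib

open Polynomial

attribute [local instance] Classical.propDecidable

noncomputable section

variable (K : Type*) [Field K]

/-- The projective general linear group `PGL₂(K)`. -/
abbrev PGL2 := Matrix.GeneralLinearGroup (Fin 2) K ⧸
  Subgroup.center (Matrix.GeneralLinearGroup (Fin 2) K)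

variable {K}

/-- entry of a matrix in `GL₂(K)` -/
def ent (A : Matrix.GeneralLinearGroup (Fin 2) K) (i j : Fin 2) : K :=
  (A : Matrix (Fin 2) (Fin 2) K) i j

/-- `(cx+d)^n · p((ax+b)/(cx+d))`, the raw (un-normalized) transform. -/
def rawAct (A : Matrix.GeneralLinearGroup (Fin 2) K) (n : ℕ) (p : Polynomial K) :
    Polynomial K :=
  ∑ i ∈ Finset.range (n + 1),
    C (p.coeff i) * (C (ent A 0 0) * X + C (ent A 0 1)) ^ i *
      (C (ent A 1 0) * X + C (ent A 1 1)) ^ (n - i)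

/-- The normalized polynomial transformation `[A]∗f`. -/
def polyAct (A : Matrix.GeneralLinearGroup (Fin 2) K) (f : Polynomial K) : Polynomial K :=
  rawAct A f.natDegree f * C (rawAct A f.natDegree f).leadingCoeff⁻¹

/-- Möbius action of `GL₂(K)` on `K̄ ∪ {∞}`; `none` plays the role of `∞`. -/
def mob (A : Matrix.GeneralLinearGroup (Fin 2) K) :
    Option (AlgebraicClosure K) → Option (AlgebraicClosure K)
  | none =>
      if algebraMap K (AlgebraicClosure K) (ent A 1 0) = 0 then none
      else some (algebraMap K (AlgebraicClosure K) (ent A 0 0) /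
        algebraMap K (AlgebraicClosure K) (ent A 1 0))
  | some x =>
      if algebraMap K (AlgebraicClosure K) (ent A 1 0) * x +
          algebraMap K (AlgebraicClosure K) (ent A 1 1) = 0 then none
      else some ((algebraMap K (AlgebraicClosure K) (ent A 0 0) * x +
          algebraMap K (AlgebraicClosure K) (ent A 0 1)) /
        (algebraMap K (AlgebraicClosure K) (ent A 1 0) * x +
          algebraMap K (AlgebraicClosure K) (ent A 1 1)))

/-- Möbius orbit of a point under a subgroup `G ≤ PGL₂(K)`. -/
def mobOrbit (G : Subgroup (PGL2 K)) (v : Option (AlgebraicClosure K)) :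
    Set (Option (AlgebraicClosure K)) :=
  {w | ∃ A : Matrix.GeneralLinearGroup (Fin 2) K,
    (QuotientGroup.mk A : PGL2 K) ∈ G ∧ mob A v = w}

/-- Orbit of a polynomial under the normalized action of `G ≤ PGL₂(K)`. -/
def polyOrbit (G : Subgroup (PGL2 K)) (r : Polynomial K) : Set (Polynomial K) :=
  {t | ∃ A : Matrix.GeneralLinearGroup (Fin 2) K,
    (QuotientGroup.mk A : PGL2 K) ∈ G ∧ polyAct A r = t}

/-- `f` has no roots in the Möbius `G`-orbit of `∞`. -/
def NoRootsInOrbitInfty (G : Subgroup (PGL2 K)) (f : Polynomial K) : Prop :=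
  ∀ x : AlgebraicClosure K, some x ∈ mobOrbit G none → Polynomial.aeval x f ≠ 0

/-- `f` is `G`-invariant for the normalized polynomial action. -/
def GInvariant (G : Subgroup (PGL2 K)) (f : Polynomial K) : Prop :=
  ∀ A : Matrix.GeneralLinearGroup (Fin 2) K,
    (QuotientGroup.mk A : PGL2 K) ∈ G → polyAct A f = f

/-- `Q_G = g/h` is a quotient map for the finite subgroup `G ≤ PGL₂(K)`:
a `G`-invariant reduced rational function with `g` monic and
`deg h < deg g = |G|` (equivalently, a normalized generator of `K(x)^G`). -/
structure IsQuotientMap (G : Subgroup (PGL2 K)) (g h : Polynomial K) : Prop where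
  monic_g : g.Monic
  h_ne : h ≠ 0
  coprime : IsCoprime g h
  deg_lt : h.natDegree < g.natDegree
  deg_eq : g.natDegree = Nat.card G
  invariant : ∀ A : Matrix.GeneralLinearGroup (Fin 2) K,
    (QuotientGroup.mk A : PGL2 K) ∈ G →
      rawAct A g.natDegree g * h = rawAct A g.natDegree h * g

/-- The `Q`-transform `F^{g/h}(x) = h(x)^{deg F} F(g(x)/h(x))`. -/
def Qtransform (g h F : Polynomial K) : Polynomial K :=
  ∑ i ∈ Finset.range (F.natDegree + 1), C (F.coeff i) * g ^ i * h ^ (F.natDegree - i)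

/-- set of roots of `f` in the algebraic closure -/
def rootSetAC (f : Polynomial K) : Set (AlgebraicClosure K) :=
  {x | Polynomial.aeval x f = 0}

end

theorem natDegree_minpoly_le_of_mem_adjoin {K L : Type*} [Field K] [Field L] [Algebra K L]
    [Algebra.IsAlgebraic K L] {v w : L} (h : v ∈ IntermediateField.adjoin K {w}) :
    (minpoly K v).natDegree ≤ (minpoly K w).natDegree := by
  have hw : IsIntegral K w := Algebra.IsIntegral.isIntegral w
  have hv : IsIntegral K v := Algebra.IsIntegral.isIntegral v
  have := IntermediateField.adjoin.finiteDimensional hw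
  rw [← IntermediateField.adjoin.finrank hw, ← IntermediateField.adjoin.finrank hv]
  exact IntermediateField.finrank_le_of_le_right
    (IntermediateField.adjoin_simple_le_iff.mpr h)

theorem natDegree_minpoly_eq_mul {K L : Type*} [Field K] [Field L] [Algebra K L]
    [Algebra.IsAlgebraic K L] {α w : L} (h : α ∈ IntermediateField.adjoin K {w}) :
    (minpoly K w).natDegree = (minpoly K α).natDegree *
      (minpoly (IntermediateField.adjoin K {α}) w).natDegree := by
  have hw : IsIntegral K w := Algebra.IsIntegral.isIntegral w
  have hα : IsIntegral K α := Algebra.IsIntegral.isIntegral α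
  have hw' : IsIntegral (IntermediateField.adjoin K {α}) w := hw.tower_top
  rw [← IntermediateField.adjoin.finrank hw, ← IntermediateField.adjoin.finrank hα,
    ← IntermediateField.adjoin.finrank hw']
  have key : (IntermediateField.adjoin (IntermediateField.adjoin K {α}) {w}).restrictScalars K
      = IntermediateField.adjoin K {w} := by
    rw [IntermediateField.adjoin_adjoin_left]
    apply le_antisymm
    · rw [IntermediateField.adjoin_le_iff]
      rintro x (hx | hx)
      · rw [Set.mem_singleton_iff.mp hx]; exact h
      · exact IntermediateField.subset_adjoin K _ hx
    · exact IntermediateField.adjoin.mono _ _ _ Set.subset_union_right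
  rw [← key]
  exact (Module.finrank_mul_finrank K (IntermediateField.adjoin K {α})
    (IntermediateField.adjoin (IntermediateField.adjoin K {α}) {w})).symm

/-- Elements of a fibre of a rational function which are conjugate over `K` are conjugate over
the field generated by the common value. -/
theorem aeval_minpoly_adjoin_eq_zero {K L : Type*} [Field K] [Field L] [Algebra K L] [Normal K L]
    {g h : K[X]} {α w w' : L} (hw' : aeval w' h ≠ 0)
    (e : aeval w g = α * aeval w h) (e' : aeval w' g = α * aeval w' h)
    (hc : minpoly K w' = minpoly K w) :
    aeval w' (minpoly (IntermediateField.adjoin K {α}) w) = 0 := by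
  obtain ⟨σ, hσ⟩ := isConjRoot_iff_exists_algEquiv.mp (show IsConjRoot K w' w from hc)
  have hσα : σ α = α := by
    have h1 : ∀ p : K[X], σ (aeval w p) = aeval w' p := fun p => by
      rw [← hσ]
      exact (aeval_algHom_apply σ.toAlgHom w p).symm
    have h2 := congrArg σ e
    rw [map_mul, h1, h1, e'] at h2
    exact (mul_right_cancel₀ hw' h2).symm
  have hfix : ∀ x : IntermediateField.adjoin K {α}, σ x = x := by
    intro x
    have : IntermediateField.adjoin K {α} ≤ IntermediateField.fixedField (Subgroup.zpowers σ) := by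
      rw [IntermediateField.adjoin_simple_le_iff, IntermediateField.mem_fixedField_iff]
      intro f hf
      exact Subgroup.zpowers_le.mpr (show σ ∈ MulAction.stabilizer (L ≃ₐ[K] L) α from hσα) hf
    exact (IntermediateField.mem_fixedField_iff _ _).mp (this x.2) σ (Subgroup.mem_zpowers σ)
  let τ : L →ₐ[IntermediateField.adjoin K {α}] L :=
    { (σ : L →+* L) with commutes' := hfix }
  have h3 := aeval_algHom_apply τ w (minpoly (IntermediateField.adjoin K {α}) w)
  rw [minpoly.aeval, map_zero] at h3
  rw [← hσ]
  exact h3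

theorem card_mul_natDegree_minpoly_le {K L : Type*} [Field K] [Field L] [Algebra K L] [Normal K L]
    {g h : K[X]} {α : L} (S : Finset L)
    (hS : ∀ w ∈ S, aeval w h ≠ 0 ∧ aeval w g = α * aeval w h) :
    S.card * (minpoly K α).natDegree ≤
      ∑ t ∈ S.image (minpoly K), t.natDegree := by
  rw [Finset.card_eq_sum_card_image (minpoly K) S, Finset.sum_mul]
  apply Finset.sum_le_sum
  intro t ht
  obtain ⟨w, hwS, rfl⟩ := Finset.mem_image.mp ht
  obtain ⟨hw, e⟩ := hS w hwS
  have hα : α ∈ IntermediateField.adjoin K {w} := by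
    have hmem (p : K[X]) : aeval w p ∈ IntermediateField.adjoin K {w} :=
      IntermediateField.algebra_adjoin_le_adjoin K {w} (aeval_mem_adjoin_singleton K w)
    rw [eq_div_of_mul_eq hw e.symm]
    exact div_mem (hmem g) (hmem h)
  rw [natDegree_minpoly_eq_mul hα, mul_comm]
  gcongr
  set P := minpoly (IntermediateField.adjoin K {α}) w
  have hP : P ≠ 0 := minpoly.ne_zero
    ((Algebra.IsIntegral.isIntegral (R := K) w).tower_top)
  calc _ ≤ (P.aroots L).toFinset.card := by
        apply Finset.card_le_card
        intro w' hw'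
        rw [Finset.mem_filter] at hw'
        obtain ⟨h1, h2⟩ := hw'
        obtain ⟨h3, h4⟩ := hS w' h1
        rw [Multiset.mem_toFinset, mem_aroots]
        exact ⟨hP, aeval_minpoly_adjoin_eq_zero h3 e h4 h2⟩
    _ ≤ (P.aroots L).card := Multiset.toFinset_card_le _
    _ ≤ (P.map (algebraMap _ L)).natDegree := card_roots' _
    _ = P.natDegree := natDegree_map _

theorem aeval_Qtransform {K L : Type*} [Field K] [Field L] [Algebra K L] (g h F : K[X]) (w : L) :
    aeval w (Qtransform g h F) = ∑ i ∈ Finset.range (F.natDegree + 1),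
      algebraMap K L (F.coeff i) * aeval w g ^ i * aeval w h ^ (F.natDegree - i) := by
  simp [Qtransform]

theorem aeval_Qtransform_of_eq_mul {K L : Type*} [Field K] [Field L] [Algebra K L]
    {g h F : K[X]} {w α : L} (e : aeval w g = α * aeval w h) :
    aeval w (Qtransform g h F) = aeval w h ^ F.natDegree * aeval α F := by
  rw [aeval_Qtransform, aeval_eq_sum_range (x := α), Finset.mul_sum]
  refine Finset.sum_congr rfl fun i hi => ?_
  have : i ≤ F.natDegree := Nat.lt_succ_iff.mp (Finset.mem_range.mp hi)
  rw [e, mul_pow, Algebra.smul_def, ← pow_mul_pow_sub _ this]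
  ring

theorem aeval_ne_zero_of_aeval_Qtransform_eq_zero {K L : Type*} [Field K] [Field L] [Algebra K L]
    {g h F : K[X]} (hF : F.Monic) (hgh : IsCoprime g h) {w : L}
    (hw : aeval w (Qtransform g h F) = 0) : aeval w h ≠ 0 := by
  intro h0
  rw [aeval_Qtransform, Finset.sum_range_succ, Finset.sum_eq_zero, zero_add,
    hF.coeff_natDegree] at hw
  · simp only [map_one, one_mul, tsub_self, pow_zero, mul_one] at hw
    have hg : aeval w g = 0 := eq_zero_of_pow_eq_zero hw
    obtain ⟨a, b, hab⟩ := hgh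
    simpa [h0, hg] using congrArg (aeval w) hab
  · intro i hi
    rw [h0, zero_pow (Nat.sub_pos_of_lt (Finset.mem_range.mp hi)).ne', mul_zero]

theorem monic_Qtransform_and_natDegree {K : Type*} [Field K] {g h F : K[X]} (hg : g.Monic)
    (hF : F.Monic) (hlt : h.natDegree < g.natDegree) :
    (Qtransform g h F).Monic ∧ (Qtransform g h F).natDegree = g.natDegree * F.natDegree := by
  have hgF : (g ^ F.natDegree).Monic := hg.pow _
  have hd : (g ^ F.natDegree).natDegree = g.natDegree * F.natDegree := by
    rw [hg.natDegree_pow, mul_comm]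
  have hsum : Qtransform g h F = g ^ F.natDegree + ∑ i ∈ Finset.range F.natDegree,
      C (F.coeff i) * g ^ i * h ^ (F.natDegree - i) := by
    rw [Qtransform, Finset.sum_range_succ, hF.coeff_natDegree, add_comm]
    simp
  have hlow : (∑ i ∈ Finset.range F.natDegree,
      C (F.coeff i) * g ^ i * h ^ (F.natDegree - i)).degree < (g ^ F.natDegree).degree := by
    rw [degree_eq_natDegree hgF.ne_zero, hd, ← mem_degreeLT]
    refine Submodule.sum_mem _ fun i hi => mem_degreeLT.mpr ?_
    have hi' := Finset.mem_range.mp hi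
    refine lt_of_le_of_lt degree_le_natDegree (Nat.cast_lt.mpr ?_)
    obtain ⟨k, hk⟩ := Nat.exists_eq_add_of_lt hi'
    have hk' : F.natDegree - i = k + 1 := by omega
    calc _ ≤ i * g.natDegree + (k + 1) * h.natDegree := by
          rw [hk']
          refine natDegree_mul_le.trans (add_le_add ?_ natDegree_pow_le)
          exact (natDegree_C_mul_le _ _).trans natDegree_pow_le
      _ < i * g.natDegree + (k + 1) * g.natDegree := by gcongr
      _ = g.natDegree * F.natDegree := by rw [hk]; ring
  rw [hsum]
  exact ⟨hgF.add_of_left hlow, by rw [natDegree_add_eq_left_of_degree_lt hlow, hd]⟩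

theorem Qtransform_eq_prod_minpoly {K L : Type*} [Field K] [Field L] [Algebra K L] [Normal K L]
    {g h F : K[X]} (hg : g.Monic) (hF : F.Monic) (hFirr : Irreducible F)
    (hlt : h.natDegree < g.natDegree) {α : L} (hα : aeval α F = 0) (S : Finset L)
    (hS : ∀ w ∈ S, aeval w h ≠ 0 ∧ aeval w g = α * aeval w h) (hcard : S.card = g.natDegree) :
    Qtransform g h F = ∏ t ∈ S.image (minpoly K), t := by
  obtain ⟨hm, hd⟩ := monic_Qtransform_and_natDegree hg hF hlt
  have hint : ∀ w : L, IsIntegral K w := Algebra.IsIntegral.isIntegral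
  have hT : ∀ t ∈ S.image (minpoly K), t.Monic ∧ Irreducible t ∧ t ∣ Qtransform g h F := by
    intro t ht
    obtain ⟨w, hw, rfl⟩ := Finset.mem_image.mp ht
    refine ⟨minpoly.monic (hint w), minpoly.irreducible (hint w), minpoly.dvd _ _ ?_⟩
    rw [aeval_Qtransform_of_eq_mul (hS w hw).2, hα, mul_zero]
  have hprod : (∏ t ∈ S.image (minpoly K), t).Monic :=
    monic_prod_of_monic _ _ fun t ht => (hT t ht).1
  refine eq_of_monic_of_dvd_of_natDegree_le hprod hm ?_ ?_
  · refine Finset.prod_dvd_of_coprime ?_ fun t ht => (hT t ht).2.2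
    intro t ht s hs hts
    refine (hT t ht).2.1.coprime_iff_not_dvd.mpr fun hdvd => hts ?_
    exact eq_of_monic_of_associated (hT t ht).1 (hT s hs).1
      ((hT t ht).2.1.associated_of_dvd (hT s hs).2.1 hdvd)
  · rw [hd, natDegree_prod_of_monic _ _ fun t ht => (hT t ht).1, ← hcard,
      minpoly.eq_of_irreducible_of_monic hFirr hα hF]
    exact card_mul_natDegree_minpoly_le S hS

section Mobius

variable {K : Type*} [Field K]

theorem aeval_rawAct {L : Type*} [Field L] [Algebra K L]
    (A : Matrix.GeneralLinearGroup (Fin 2) K) (n : ℕ) (p : K[X]) (x : L) :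
    aeval x (rawAct A n p) = ∑ i ∈ Finset.range (n + 1), algebraMap K L (p.coeff i) *
      (algebraMap K L (ent A 0 0) * x + algebraMap K L (ent A 0 1)) ^ i *
      (algebraMap K L (ent A 1 0) * x + algebraMap K L (ent A 1 1)) ^ (n - i) := by
  simp [rawAct]

theorem aeval_rawAct_of_eq_mul {L : Type*} [Field L] [Algebra K L]
    (A : Matrix.GeneralLinearGroup (Fin 2) K) {n : ℕ} {p : K[X]} (hp : p.natDegree ≤ n) {x y : L}
    (e : algebraMap K L (ent A 0 0) * x + algebraMap K L (ent A 0 1) =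
      y * (algebraMap K L (ent A 1 0) * x + algebraMap K L (ent A 1 1))) :
    aeval x (rawAct A n p) =
      (algebraMap K L (ent A 1 0) * x + algebraMap K L (ent A 1 1)) ^ n * aeval y p := by
  rw [aeval_rawAct, aeval_eq_sum_range' (Nat.lt_succ_iff.mpr hp), Finset.mul_sum]
  refine Finset.sum_congr rfl fun i hi => ?_
  have : i ≤ n := Nat.lt_succ_iff.mp (Finset.mem_range.mp hi)
  rw [e, mul_pow, Algebra.smul_def, ← pow_mul_pow_sub _ this]
  ring

theorem aeval_rawAct_of_denom_eq_zero {L : Type*} [Field L] [Algebra K L]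
    (A : Matrix.GeneralLinearGroup (Fin 2) K) (n : ℕ) (p : K[X]) {x : L}
    (e : algebraMap K L (ent A 1 0) * x + algebraMap K L (ent A 1 1) = 0) :
    aeval x (rawAct A n p) = algebraMap K L (p.coeff n) *
      (algebraMap K L (ent A 0 0) * x + algebraMap K L (ent A 0 1)) ^ n := by
  rw [aeval_rawAct, Finset.sum_range_succ, Finset.sum_eq_zero, zero_add]
  · simp
  · intro i hi
    rw [e, zero_pow (Nat.sub_pos_of_lt (Finset.mem_range.mp hi)).ne', mul_zero]

theorem natDegree_rawAct_le (A : Matrix.GeneralLinearGroup (Fin 2) K) (n : ℕ) (p : K[X]) :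
    (rawAct A n p).natDegree ≤ n := by
  refine natDegree_sum_le_of_forall_le _ _ fun i hi => ?_
  have : i ≤ n := Nat.lt_succ_iff.mp (Finset.mem_range.mp hi)
  calc _ ≤ i * 1 + (n - i) * 1 := by
        refine natDegree_mul_le.trans (add_le_add ((natDegree_C_mul_le _ _).trans ?_) ?_)
        · exact natDegree_pow_le_of_le _ natDegree_linear_le
        · exact natDegree_pow_le_of_le _ natDegree_linear_le
    _ = n := by omega

/-- If `y` has image `x` under `A⁻¹`, then `A` maps `x` back to `y`. -/
theorem mobius_inv_cancel {L : Type*} [Field L] [Algebra K L]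
    (A : Matrix.GeneralLinearGroup (Fin 2) K) {x y : L}
    (hden : algebraMap K L (ent A⁻¹ 1 0) * y + algebraMap K L (ent A⁻¹ 1 1) ≠ 0)
    (hx : x = (algebraMap K L (ent A⁻¹ 0 0) * y + algebraMap K L (ent A⁻¹ 0 1)) /
      (algebraMap K L (ent A⁻¹ 1 0) * y + algebraMap K L (ent A⁻¹ 1 1))) :
    algebraMap K L (ent A 1 0) * x + algebraMap K L (ent A 1 1) ≠ 0 ∧
    algebraMap K L (ent A 0 0) * x + algebraMap K L (ent A 0 1) =
      y * (algebraMap K L (ent A 1 0) * x + algebraMap K L (ent A 1 1)) := by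
  have hAB : (A : Matrix (Fin 2) (Fin 2) K) * (A⁻¹ : Matrix.GeneralLinearGroup (Fin 2) K) = 1 := by
    rw [← Units.val_mul, mul_inv_cancel, Units.val_one]
  have hent : ∀ i j, algebraMap K L (ent A i 0) * algebraMap K L (ent A⁻¹ 0 j) +
      algebraMap K L (ent A i 1) * algebraMap K L (ent A⁻¹ 1 j) = if i = j then 1 else 0 := by
    intro i j
    have h := congrFun (congrFun hAB i) j
    rw [Matrix.mul_apply, Fin.sum_univ_two, Matrix.one_apply] at h
    rw [← map_mul, ← map_mul, ← map_add]
    refine (congrArg (algebraMap K L) h).trans ?_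
    split_ifs <;> simp
  have h00 := hent 0 0
  have h01 := hent 0 1
  have h10 := hent 1 0
  have h11 := hent 1 1
  simp only [↓reduceIte, zero_ne_one, one_ne_zero] at h00 h01 h10 h11
  set D := algebraMap K L (ent A⁻¹ 1 0) * y + algebraMap K L (ent A⁻¹ 1 1) with hD
  have hxD : x * D = algebraMap K L (ent A⁻¹ 0 0) * y + algebraMap K L (ent A⁻¹ 0 1) := by
    rw [hx, div_mul_cancel₀ _ hden]
  have hbot : (algebraMap K L (ent A 1 0) * x + algebraMap K L (ent A 1 1)) * D = 1 := by
    linear_combination algebraMap K L (ent A 1 0) * hxD + algebraMap K L (ent A 1 1) * hD +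
      y * h10 + h11
  have htop : (algebraMap K L (ent A 0 0) * x + algebraMap K L (ent A 0 1)) * D = y := by
    linear_combination algebraMap K L (ent A 0 0) * hxD + algebraMap K L (ent A 0 1) * hD +
      y * h00 + h01
  refine ⟨left_ne_zero_of_mul_eq_one hbot, mul_right_cancel₀ hden ?_⟩
  rw [htop, mul_assoc, hbot, mul_one]

theorem ent_denom_ne_zero (A : Matrix.GeneralLinearGroup (Fin 2) K) :
    ¬ (ent A 1 0 = 0 ∧ ent A 1 1 = 0) := by
  rintro ⟨h0, h1⟩
  have hdet : (A : Matrix (Fin 2) (Fin 2) K).det ≠ 0 :=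
    ((Matrix.isUnit_iff_isUnit_det _).mp A.isUnit).ne_zero
  rw [Matrix.det_fin_two] at hdet
  simp only [ent] at h0 h1
  simp [h0, h1] at hdet

theorem mobius_num_ne_zero {L : Type*} [Field L] [Algebra K L]
    (A : Matrix.GeneralLinearGroup (Fin 2) K) {x : L}
    (hx : algebraMap K L (ent A 1 0) * x + algebraMap K L (ent A 1 1) = 0) :
    algebraMap K L (ent A 0 0) * x + algebraMap K L (ent A 0 1) ≠ 0 := by
  intro h0
  have hdet : (A : Matrix (Fin 2) (Fin 2) K).det ≠ 0 :=
    ((Matrix.isUnit_iff_isUnit_det _).mp A.isUnit).ne_zero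
  have hdet' : algebraMap K L (ent A 0 0 * ent A 1 1 - ent A 0 1 * ent A 1 0) = 0 := by
    rw [map_sub, map_mul, map_mul]
    linear_combination algebraMap K L (ent A 0 0) * hx - algebraMap K L (ent A 1 0) * h0
  rw [map_eq_zero] at hdet'
  rw [Matrix.det_fin_two] at hdet
  exact hdet hdet'

theorem rawAct_ne_zero (A : Matrix.GeneralLinearGroup (Fin 2) K) {p : K[X]} (hp : p ≠ 0) :
    rawAct A p.natDegree p ≠ 0 := by
  let L := AlgebraicClosure K
  have hlin : C (ent A⁻¹ 1 0) * X + C (ent A⁻¹ 1 1) ≠ (0 : K[X]) := by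
    intro h0
    refine ent_denom_ne_zero A⁻¹ ⟨?_, ?_⟩
    · simpa using congrArg (coeff · 1) h0
    · simpa using congrArg (coeff · 0) h0
  have hprod := mul_ne_zero hp hlin
  obtain ⟨y, hy⟩ := Infinite.exists_notMem_finset
    ((p * (C (ent A⁻¹ 1 0) * X + C (ent A⁻¹ 1 1))).aroots L).toFinset
  rw [Multiset.mem_toFinset, mem_aroots, not_and] at hy
  have hy' := hy hprod
  simp only [map_mul, map_add, aeval_C, aeval_X, mul_eq_zero, not_or] at hy'
  obtain ⟨h1, h2⟩ := mobius_inv_cancel A hy'.2 rfl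
  intro h0
  have h3 := aeval_rawAct_of_eq_mul A le_rfl (p := p) h2
  rw [h0, map_zero] at h3
  exact mul_ne_zero (pow_ne_zero _ h1) hy'.1 h3.symm

theorem polyAct_minpoly {L : Type*} [Field L] [Algebra K L] [Algebra.IsAlgebraic K L]
    (A : Matrix.GeneralLinearGroup (Fin 2) K) {v w : L}
    (hden : algebraMap K L (ent A 1 0) * w + algebraMap K L (ent A 1 1) ≠ 0)
    (e : algebraMap K L (ent A 0 0) * w + algebraMap K L (ent A 0 1) =
      v * (algebraMap K L (ent A 1 0) * w + algebraMap K L (ent A 1 1))) :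
    polyAct A (minpoly K v) = minpoly K w := by
  have hv : IsIntegral K v := Algebra.IsIntegral.isIntegral v
  have hne := rawAct_ne_zero A (minpoly.ne_zero hv)
  have hmem : v ∈ IntermediateField.adjoin K {w} := by
    have hw := IntermediateField.mem_adjoin_simple_self K w
    rw [eq_div_of_mul_eq hden e.symm]
    exact div_mem
      (add_mem (mul_mem (algebraMap_mem _ _) hw) (algebraMap_mem _ _))
      (add_mem (mul_mem (algebraMap_mem _ _) hw) (algebraMap_mem _ _))
  have hmonic : (polyAct A (minpoly K v)).Monic := monic_mul_leadingCoeff_inv hne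
  have hroot : aeval w (polyAct A (minpoly K v)) = 0 := by
    rw [polyAct, map_mul, aeval_rawAct_of_eq_mul A le_rfl e, minpoly.aeval, mul_zero, zero_mul]
  refine eq_of_monic_of_dvd_of_natDegree_le
    (minpoly.monic (Algebra.IsIntegral.isIntegral w)) hmonic (minpoly.dvd _ _ hroot) ?_
  calc _ ≤ (rawAct A (minpoly K v).natDegree (minpoly K v)).natDegree := natDegree_mul_C_le _ _
    _ ≤ (minpoly K v).natDegree := natDegree_rawAct_le _ _ _
    _ ≤ _ := natDegree_minpoly_le_of_mem_adjoin hmem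

namespace IsQuotientMap

variable {G : Subgroup (PGL2 K)} {g h : K[X]} {L : Type*} [Field L] [Algebra K L]

theorem mobius_denom_ne_zero (hQ : IsQuotientMap G g h)
    {A : Matrix.GeneralLinearGroup (Fin 2) K} (hA : (QuotientGroup.mk A : PGL2 K) ∈ G) {v : L}
    (hv : aeval v h ≠ 0) :
    algebraMap K L (ent A 1 0) * v + algebraMap K L (ent A 1 1) ≠ 0 := by
  intro h0
  have hinv := congrArg (aeval v) (hQ.invariant A hA)
  rw [map_mul, map_mul, aeval_rawAct_of_denom_eq_zero A _ _ h0,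
    aeval_rawAct_of_denom_eq_zero A _ _ h0, coeff_eq_zero_of_natDegree_lt hQ.deg_lt,
    hQ.monic_g.coeff_natDegree, map_one, one_mul, map_zero, zero_mul, zero_mul] at hinv
  exact mul_ne_zero (pow_ne_zero _ (mobius_num_ne_zero A h0)) hv hinv

theorem fiber_mobius (hQ : IsQuotientMap G g h)
    {A : Matrix.GeneralLinearGroup (Fin 2) K} (hA : (QuotientGroup.mk A : PGL2 K) ∈ G) {v w α : L}
    (hv : aeval v h ≠ 0) (hα : aeval v g = α * aeval v h)
    (hw : w = (algebraMap K L (ent A 0 0) * v + algebraMap K L (ent A 0 1)) /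
      (algebraMap K L (ent A 1 0) * v + algebraMap K L (ent A 1 1))) :
    aeval w h ≠ 0 ∧ aeval w g = α * aeval w h := by
  have hden := hQ.mobius_denom_ne_zero hA hv
  have e : algebraMap K L (ent A 0 0) * v + algebraMap K L (ent A 0 1) =
      w * (algebraMap K L (ent A 1 0) * v + algebraMap K L (ent A 1 1)) := by
    rw [hw, div_mul_cancel₀ _ hden]
  have hinv := congrArg (aeval v) (hQ.invariant A hA)
  rw [map_mul, map_mul, aeval_rawAct_of_eq_mul A le_rfl e,
    aeval_rawAct_of_eq_mul A hQ.deg_lt.le e, hα] at hinv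
  have hval : aeval w g = α * aeval w h := by
    refine mul_left_cancel₀ (mul_ne_zero (pow_ne_zero g.natDegree hden) hv) ?_
    linear_combination hinv
  refine ⟨fun h0 => ?_, hval⟩
  obtain ⟨a, b, hab⟩ := hQ.coprime
  simpa [h0, hval] using congrArg (aeval w) hab

end IsQuotientMap

end Mobius

theorem k_eq_one_of_regular {K : Type*} [Field K] (G : Subgroup (PGL2 K))
    (hGfin : (G : Set (PGL2 K)).Finite) (g h : Polynomial K) (hQ : IsQuotientMap G g h)
    (F : Polynomial K) (hF : F.Monic) (hFirr : Irreducible F)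
    (hreg : ∀ v : AlgebraicClosure K, v ∈ rootSetAC (Qtransform g h F) →
      (mobOrbit G (some v)).ncard = Nat.card G) :
    ∃ (r : Polynomial K) (hfin : (polyOrbit G r).Finite),
      r.Monic ∧ Irreducible r ∧ Qtransform g h F = ∏ t ∈ hfin.toFinset, t := by
  let L := AlgebraicClosure K
  have hn : 0 < Nat.card G := by
    have : Finite G := hGfin
    exact Nat.card_pos
  obtain ⟨hm, hd⟩ := monic_Qtransform_and_natDegree hQ.monic_g hF hQ.deg_lt
  obtain ⟨v, hv⟩ : ∃ v : L, aeval v (Qtransform g h F) = 0 := by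
    refine IsAlgClosed.exists_aeval_eq_zero L _ (natDegree_pos_iff_degree_pos.mp ?_).ne'
    rw [hd, hQ.deg_eq]
    exact Nat.mul_pos hn hFirr.natDegree_pos
  have hh := aeval_ne_zero_of_aeval_Qtransform_eq_zero hF hQ.coprime hv
  obtain ⟨α, hα⟩ : ∃ α : L, aeval v g = α * aeval v h :=
    ⟨aeval v g / aeval v h, (div_mul_cancel₀ _ hh).symm⟩
  have hFα : aeval α F = 0 := by
    rw [aeval_Qtransform_of_eq_mul hα] at hv
    exact (mul_eq_zero.mp hv).resolve_left (pow_ne_zero _ hh)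
  let φ : Matrix.GeneralLinearGroup (Fin 2) K → L := fun A =>
    (algebraMap K L (ent A 0 0) * v + algebraMap K L (ent A 0 1)) /
      (algebraMap K L (ent A 1 0) * v + algebraMap K L (ent A 1 1))
  have hmob : ∀ A : Matrix.GeneralLinearGroup (Fin 2) K, (QuotientGroup.mk A : PGL2 K) ∈ G →
      mob A (some v) = some (φ A) := fun A hA =>
    if_neg (hQ.mobius_denom_ne_zero hA hh)
  let S : Set L := φ '' {A | (QuotientGroup.mk A : PGL2 K) ∈ G}
  have horb : mobOrbit G (some v) = some '' S := by
    ext w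
    constructor
    · rintro ⟨A, hA, rfl⟩
      exact ⟨φ A, ⟨A, hA, rfl⟩, (hmob A hA).symm⟩
    · rintro ⟨_, ⟨A, hA, rfl⟩, rfl⟩
      exact ⟨A, hA, hmob A hA⟩
  have hcard : S.ncard = Nat.card G := by
    rw [← hreg v hv, horb, Set.ncard_image_of_injective _ (Option.some_injective _)]
  have hSfin : S.Finite := Set.finite_of_ncard_pos (hcard ▸ hn)
  have hinv : ∀ A : Matrix.GeneralLinearGroup (Fin 2) K, (QuotientGroup.mk A : PGL2 K) ∈ G →
      (QuotientGroup.mk A⁻¹ : PGL2 K) ∈ G := fun A hA => inv_mem hA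
  have hact : ∀ A : Matrix.GeneralLinearGroup (Fin 2) K, (QuotientGroup.mk A : PGL2 K) ∈ G →
      polyAct A (minpoly K v) = minpoly K (φ A⁻¹) := by
    intro A hA
    obtain ⟨h1, h2⟩ := mobius_inv_cancel A (hQ.mobius_denom_ne_zero (hinv A hA) hh) rfl
    exact polyAct_minpoly A h1 h2
  have hpoly : polyOrbit G (minpoly K v) = ↑(hSfin.toFinset.image (minpoly K)) := by
    rw [Finset.coe_image, Set.Finite.coe_toFinset]
    ext t
    constructor
    · rintro ⟨A, hA, rfl⟩
      exact ⟨φ A⁻¹, ⟨A⁻¹, hinv A hA, rfl⟩,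
        (hact A hA).symm⟩
    · rintro ⟨_, ⟨A, hA, rfl⟩, rfl⟩
      exact ⟨A⁻¹, hinv A hA, by rw [hact A⁻¹ (hinv A hA), inv_inv]⟩
  have hvint : IsIntegral K v := Algebra.IsIntegral.isIntegral v
  have hfin : (polyOrbit G (minpoly K v)).Finite := hpoly ▸ Finset.finite_toSet _
  refine ⟨minpoly K v, hfin, minpoly.monic hvint, minpoly.irreducible hvint, ?_⟩
  have hT : hfin.toFinset = hSfin.toFinset.image (minpoly K) := by
    rw [← Finset.coe_inj, Set.Finite.coe_toFinset, hpoly]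
  rw [hT]
  refine Qtransform_eq_prod_minpoly hQ.monic_g hF hFirr hQ.deg_lt hFα _ ?_ ?_
  · intro w hw
    obtain ⟨A, hA, rfl⟩ := hSfin.mem_toFinset.mp hw
    exact hQ.fiber_mobius hA hh hα rfl
  · rw [hQ.deg_eq, ← hcard, Set.ncard_eq_toFinset_card S hSfin]
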